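/- Let t₀ > 0, let a be real with 0 < a < 1/t₀, and let c ≥ 0, b > 0, k > 0 be real constants. Define f : ℂ → ℂ by f(λ) = t₀ (λt₀ − 1)^{−1} λ^c exp(−bλ^k), with principal-branch complex powers. Then the three integrals below converge absolutely and −∫_{−∞}^{−a} f(−t + i) dt − i·∫_{−1}^{1} f(a − ti) dt + ∫_{a}^{∞} f(t − i) dt = 2πi · t₀^{−c} · exp(−b · t₀^{−k}). -/

import Mathlib

open MeasureTheory Complex

section

open Filter Topology Set
open scoped Interval

/-- The logarithm is a primitive of `w / (z + t w)` along a segment which a rotation by `u`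
moves into the slit plane. -/
lemma integral_mul_inv_segment (z w u : ℂ) (a b : ℝ)
    (h : ∀ t ∈ uIcc a b, u * (z + t * w) ∈ slitPlane) :
    w * ∫ t in a..b, (z + t * w)⁻¹ = log (u * (z + b * w)) - log (u * (z + a * w)) := by
  have hne : ∀ t ∈ uIcc a b, z + t * w ≠ 0 := fun t ht h0 => by
    have := h t ht
    simp [h0] at this
  have hu : u ≠ 0 := fun h0 => by
    have := h a left_mem_uIcc
    simp [h0] at this
  rw [← intervalIntegral.integral_const_mul]
  refine intervalIntegral.integral_eq_sub_of_hasDerivAt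
    (f := fun t : ℝ => log (u * (z + t * w))) (fun t ht => ?_) ?_
  · have h1 : HasDerivAt (fun t : ℝ => u * (z + t * w)) (u * (1 * w)) t :=
      (((hasDerivAt_id t).ofReal_comp.mul_const w).const_add z).const_mul u
    refine (h1.clog_real (h t ht)).congr_deriv ?_
    have := hne t ht
    field_simp
  · refine ContinuousOn.intervalIntegrable (continuousOn_const.mul (ContinuousOn.inv₀ ?_ hne))
    fun_prop

lemma log_neg_of_im_pos {z : ℂ} (hz : 0 < z.im) : log (-z) = log z - Real.pi * I := by
  simp only [log, norm_neg, arg_neg_eq_arg_sub_pi_of_im_pos hz]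
  push_cast
  ring

lemma log_neg_of_im_neg {z : ℂ} (hz : z.im < 0) : log (-z) = log z + Real.pi * I := by
  simp only [log, norm_neg, arg_neg_eq_arg_add_pi_of_im_neg hz]
  push_cast
  ring

/-- The boundary of a rectangle winds once around each interior point. -/
lemma integral_boundary_rect_inv_sub {z w p : ℂ} (h1 : z.re < p.re) (h2 : p.re < w.re)
    (h3 : z.im < p.im) (h4 : p.im < w.im) :
    (∫ x : ℝ in z.re..w.re, (x + z.im * I - p)⁻¹) -
      (∫ x : ℝ in z.re..w.re, (x + w.im * I - p)⁻¹) +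
      I * (∫ y : ℝ in z.im..w.im, (w.re + y * I - p)⁻¹) -
      I * (∫ y : ℝ in z.im..w.im, (z.re + y * I - p)⁻¹) = 2 * Real.pi * I := by
  have e1 := integral_mul_inv_segment (z.im * I - p) 1 1 z.re w.re (fun t _ => by
    rw [mem_slitPlane_iff]; right; simp; linarith)
  have e2 := integral_mul_inv_segment (w.im * I - p) 1 1 z.re w.re (fun t _ => by
    rw [mem_slitPlane_iff]; right; simp; linarith)
  have e3 := integral_mul_inv_segment (w.re - p) I 1 z.im w.im (fun t _ => by
    rw [mem_slitPlane_iff]; left; simp; linarith)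
  have e4 := integral_mul_inv_segment (z.re - p) I (-1) z.im w.im (fun t _ => by
    rw [mem_slitPlane_iff]; left; simp; linarith)
  simp only [one_mul, mul_one, neg_one_mul] at e1 e2 e3 e4
  rw [log_neg_of_im_pos (by simp; linarith), log_neg_of_im_neg (by simp; linarith)] at e4
  have a1 : ∀ x y : ℂ, x + y - p = y - p + x := fun x y => by ring
  have a2 : ∀ x y : ℂ, x + y - p = x - p + y := fun x y => by ring
  simp only [a1 _ (_ * I), e1, e2]
  simp only [← a1 _ (_ * I), a2, e3, e4]
  ring

lemma integral_inv_sub_mul_eq_dslope_add {g : ℂ → ℂ} {p : ℂ} {S : Set ℂ} {γ : ℝ → ℂ} {a b : ℝ}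
    (hS : S ∈ 𝓝 p) (hg : DifferentiableOn ℂ g S) (hγ : Continuous γ)
    (hγS : ∀ t ∈ uIcc a b, γ t ∈ S) (hγp : ∀ t ∈ uIcc a b, γ t ≠ p) :
    ∫ t in a..b, (γ t - p)⁻¹ * g (γ t) =
      (∫ t in a..b, dslope g p (γ t)) + g p * ∫ t in a..b, (γ t - p)⁻¹ := by
  have hd : ContinuousOn (dslope g p) S := ((differentiableOn_dslope hS).2 hg).continuousOn
  rw [← intervalIntegral.integral_const_mul, ← intervalIntegral.integral_add]
  · refine intervalIntegral.integral_congr fun t ht => ?_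
    have := sub_ne_zero.2 (hγp t ht)
    simp only [dslope_of_ne _ (hγp t ht), slope_def_field]
    field_simp
    ring
  · exact (hd.comp hγ.continuousOn hγS).intervalIntegrable
  · refine ContinuousOn.intervalIntegrable (continuousOn_const.mul (ContinuousOn.inv₀ ?_ ?_))
    · fun_prop
    · exact fun t ht => sub_ne_zero.2 (hγp t ht)

/-- Cauchy's integral formula on a rectangle. -/
lemma integral_boundary_rect_inv_sub_mul {g : ℂ → ℂ} {z w p : ℂ}
    (h1 : z.re < p.re) (h2 : p.re < w.re) (h3 : z.im < p.im) (h4 : p.im < w.im)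
    (hg : DifferentiableOn ℂ g ([[z.re, w.re]] ×ℂ [[z.im, w.im]])) :
    (∫ x : ℝ in z.re..w.re, (x + z.im * I - p)⁻¹ * g (x + z.im * I)) -
      (∫ x : ℝ in z.re..w.re, (x + w.im * I - p)⁻¹ * g (x + w.im * I)) +
      I * (∫ y : ℝ in z.im..w.im, (w.re + y * I - p)⁻¹ * g (w.re + y * I)) -
      I * (∫ y : ℝ in z.im..w.im, (z.re + y * I - p)⁻¹ * g (z.re + y * I)) =
      2 * Real.pi * I * g p := by
  have hS : [[z.re, w.re]] ×ℂ [[z.im, w.im]] ∈ 𝓝 p := by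
    rw [uIcc_of_le (h1.trans h2).le, uIcc_of_le (h3.trans h4).le]
    exact inter_mem (continuous_re.continuousAt.preimage_mem_nhds (Icc_mem_nhds h1 h2))
      (continuous_im.continuousAt.preimage_mem_nhds (Icc_mem_nhds h3 h4))
  have key := integral_boundary_rect_eq_zero_of_differentiableOn _ z w
    ((differentiableOn_dslope hS).2 hg)
  have hinv := integral_boundary_rect_inv_sub h1 h2 h3 h4
  have ne_re : ∀ q : ℂ, q.re ≠ p.re → q ≠ p := fun q h h' => h (by rw [h'])
  have ne_im : ∀ q : ℂ, q.im ≠ p.im → q ≠ p := fun q h h' => h (by rw [h'])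
  rw [integral_inv_sub_mul_eq_dslope_add (γ := fun x : ℝ => x + z.im * I) hS hg (by fun_prop)
      (fun t ht => by simpa [mem_reProdIm] using ht)
      (fun t _ => ne_im _ (by simpa using h3.ne)),
    integral_inv_sub_mul_eq_dslope_add (γ := fun x : ℝ => x + w.im * I) hS hg (by fun_prop)
      (fun t ht => by simpa [mem_reProdIm] using ht)
      (fun t _ => ne_im _ (by simpa using h4.ne')),
    integral_inv_sub_mul_eq_dslope_add (γ := fun y : ℝ => w.re + y * I) hS hg (by fun_prop)
      (fun t ht => by simpa [mem_reProdIm] using ht)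
      (fun t _ => ne_re _ (by simpa using h2.ne')),
    integral_inv_sub_mul_eq_dslope_add (γ := fun y : ℝ => z.re + y * I) hS hg (by fun_prop)
      (fun t ht => by simpa [mem_reProdIm] using ht)
      (fun t _ => ne_re _ (by simpa using h1.ne))]
  simp only [smul_eq_mul] at key
  linear_combination key + g p * hinv

/-- Far to the right in the strip `|im z| ≤ 1`, the function `z ^ c * exp (-b z ^ k)` is
dominated by `(re z) ^ (-2)`. -/
lemma eventually_norm_cpow_mul_exp_neg_le {b c k : ℝ} (hc : 0 ≤ c) (hb : 0 < b) (hk : 0 < k) :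
    ∀ᶠ x : ℝ in atTop, ∀ y ∈ Icc (-1 : ℝ) 1,
      ‖((x + y * I : ℂ) ^ (c : ℂ)) * exp (-(b : ℂ) * (x + y * I : ℂ) ^ (k : ℂ))‖ ≤
        x ^ (-2 : ℝ) := by
  have hcos : ∀ᶠ z : ℂ in 𝓝 1, 1 / 2 < Real.cos (arg z * k) := by
    have h1 : ContinuousAt (fun z : ℂ => Real.cos (arg z * k)) 1 :=
      Real.continuous_cos.continuousAt.comp
        ((continuousAt_arg (by simp)).mul continuousAt_const)
    exact h1.eventually_const_lt (by norm_num)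
  obtain ⟨δ, hδ, hcos⟩ := Metric.eventually_nhds_iff.1 hcos
  have hdecay : ∀ᶠ x : ℝ in atTop,
      2 ^ c * ((x ^ k) ^ ((c + 2) / k) * Real.exp (-(b / 2) * x ^ k)) < 1 := by
    have := (((tendsto_rpow_mul_exp_neg_mul_atTop_nhds_zero ((c + 2) / k) (b / 2)
      (by positivity)).comp (tendsto_rpow_atTop hk)).const_mul (2 ^ c))
    rw [mul_zero] at this
    exact this.eventually_lt_const one_pos
  filter_upwards [hdecay, eventually_gt_atTop (1 / δ), eventually_ge_atTop 1]
    with x hx hxδ hx1 y hy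
  have hx0 : 0 < x := by linarith
  have hyabs : |y| ≤ 1 := abs_le.2 hy
  set z : ℂ := x + y * I with hz
  have hre : z.re = x := by simp [hz]
  have hlow : x ≤ ‖z‖ := hre ▸ re_le_norm z
  have hupp : ‖z‖ ≤ 2 * x := by
    calc ‖z‖ ≤ ‖(x : ℂ)‖ + ‖(y * I : ℂ)‖ := norm_add_le _ _
      _ = x + |y| := by simp [abs_of_pos hx0]
      _ ≤ 2 * x := by linarith
  have harg : arg z = arg (1 + (y / x : ℝ) * I) := by
    rw [← arg_real_mul (1 + (y / x : ℝ) * I) hx0]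
    congr 1
    have : (x : ℂ) ≠ 0 := by exact_mod_cast hx0.ne'
    rw [hz]
    push_cast
    field_simp
  have hcosz : 1 / 2 < Real.cos (arg z * k) := by
    rw [harg]
    refine hcos ?_
    rw [dist_eq, add_sub_cancel_left, norm_mul, norm_I, mul_one, norm_real, Real.norm_eq_abs,
      abs_div, abs_of_pos hx0, div_lt_iff₀ hx0]
    rw [div_lt_iff₀ hδ] at hxδ
    linarith
  have hrek : (b / 2) * x ^ k ≤ b * (z ^ (k : ℂ)).re := by
    rw [cpow_ofReal_re]
    have h1 : x ^ k ≤ ‖z‖ ^ k := Real.rpow_le_rpow hx0.le hlow hk.le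
    have h2 : 0 < x ^ k := Real.rpow_pos_of_pos hx0 k
    have : x ^ k * (1 / 2) ≤ ‖z‖ ^ k * Real.cos (arg z * k) := by gcongr
    nlinarith
  have hpow : (x ^ k) ^ ((c + 2) / k) = x ^ c * x ^ (2 : ℝ) := by
    rw [← Real.rpow_mul hx0.le, mul_div_cancel₀ _ hk.ne', Real.rpow_add hx0]
  rw [norm_mul, norm_cpow_real, norm_exp]
  have hre' : (-(b : ℂ) * z ^ (k : ℂ)).re = -(b * (z ^ (k : ℂ)).re) := by simp
  rw [hre', Real.rpow_neg hx0.le, ← one_div, le_div_iff₀ (by positivity)]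
  calc ‖z‖ ^ c * Real.exp (-(b * (z ^ (k : ℂ)).re)) * x ^ (2 : ℝ)
      ≤ (2 * x) ^ c * Real.exp (-(b / 2) * x ^ k) * x ^ (2 : ℝ) := by
        gcongr
        linarith
    _ = 2 ^ c * ((x ^ k) ^ ((c + 2) / k) * Real.exp (-(b / 2) * x ^ k)) := by
        rw [hpow, Real.mul_rpow zero_le_two hx0.le]
        ring
    _ ≤ 1 := hx.le

/-- Cauchy's integral formula on a half-strip, for functions decaying to the right. -/
lemma integral_boundary_halfStrip_inv_sub_mul {g : ℂ → ℂ} {a p : ℝ} (hap : a < p)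
    (hg : DifferentiableOn ℂ g {z | a ≤ z.re})
    (hdecay : ∀ᶠ x : ℝ in atTop, ∀ y ∈ Icc (-1 : ℝ) 1, ‖g (x + y * I)‖ ≤ x ^ (-2 : ℝ)) :
    (∀ y ∈ ({-1, 1} : Set ℝ),
      IntegrableOn (fun x : ℝ => (x + y * I - p : ℂ)⁻¹ * g (x + y * I)) (Ici a)) ∧
    IntervalIntegrable (fun y : ℝ => (a + y * I - p : ℂ)⁻¹ * g (a + y * I)) volume (-1) 1 ∧
    (∫ x in Ici a, (x + (-1 : ℝ) * I - p : ℂ)⁻¹ * g (x + (-1 : ℝ) * I)) -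
      (∫ x in Ici a, (x + (1 : ℝ) * I - p : ℂ)⁻¹ * g (x + (1 : ℝ) * I)) -
      I * (∫ y in (-1 : ℝ)..1, (a + y * I - p : ℂ)⁻¹ * g (a + y * I)) =
      2 * Real.pi * I * g p := by
  have hbound : ∀ᶠ x : ℝ in atTop, ∀ y ∈ Icc (-1 : ℝ) 1,
      ‖(x + y * I - p : ℂ)⁻¹ * g (x + y * I)‖ ≤ x ^ (-2 : ℝ) := by
    filter_upwards [hdecay, eventually_ge_atTop (p + 1)] with x hx hxp y hy
    have h1 : 1 ≤ ‖(x + y * I - p : ℂ)‖ := by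
      refine le_trans ?_ (re_le_norm _)
      simp
      linarith
    rw [norm_mul, norm_inv]
    calc _ ≤ 1 * ‖g (x + y * I)‖ := by gcongr; exact inv_le_one_of_one_le₀ h1
      _ ≤ _ := by rw [one_mul]; exact hx y hy
  have hedge : ∀ y ∈ ({-1, 1} : Set ℝ),
      IntegrableOn (fun x : ℝ => (x + y * I - p : ℂ)⁻¹ * g (x + y * I)) (Ici a) := by
    intro y hy
    have hy0 : y ≠ 0 := by rintro rfl; simp at hy
    have hy1 : y ∈ Icc (-1 : ℝ) 1 := by
      rcases hy with rfl | rfl <;> norm_num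
    have hcont : ContinuousOn (fun x : ℝ => (x + y * I - p : ℂ)⁻¹ * g (x + y * I)) (Ici a) := by
      refine ContinuousOn.mul (ContinuousOn.inv₀ (by fun_prop) fun x _ h0 => hy0 ?_)
        (hg.continuousOn.comp (by fun_prop) fun x hx => by simpa using hx)
      simpa using congrArg im h0
    refine (hcont.locallyIntegrableOn measurableSet_Ici).integrableOn_of_isBigO_atTop
      (g := fun x : ℝ => x ^ (-2 : ℝ)) (Asymptotics.IsBigO.of_bound 1 ?_)
      (integrableAtFilter_rpow_atTop_iff.2 (by norm_num))
    filter_upwards [hbound] with x hx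
    rw [one_mul]
    exact (hx y hy1).trans (Real.le_norm_self _)
  have hleft : IntervalIntegrable (fun y : ℝ => (a + y * I - p : ℂ)⁻¹ * g (a + y * I))
      volume (-1) 1 := by
    refine ContinuousOn.intervalIntegrable (ContinuousOn.mul
      (ContinuousOn.inv₀ (by fun_prop) fun y _ h0 => hap.ne ?_)
      (hg.continuousOn.comp (by fun_prop) fun y _ => by simp))
    simpa [sub_eq_zero] using congrArg re h0
  refine ⟨hedge, hleft, ?_⟩
  have hlim : ∀ y ∈ ({-1, 1} : Set ℝ),
      Tendsto (fun R : ℝ => ∫ x in a..R, (x + y * I - p : ℂ)⁻¹ * g (x + y * I)) atTop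
        (𝓝 (∫ x in Ici a, (x + y * I - p : ℂ)⁻¹ * g (x + y * I))) := fun y hy => by
    rw [integral_Ici_eq_integral_Ioi]
    exact intervalIntegral_tendsto_integral_Ioi a
      ((hedge y hy).mono_set Ioi_subset_Ici_self) tendsto_id
  have hright : Tendsto (fun R : ℝ => ∫ y in (-1 : ℝ)..1,
      (R + y * I - p : ℂ)⁻¹ * g (R + y * I)) atTop (𝓝 0) := by
    have h0 : Tendsto (fun R : ℝ => R ^ (-2 : ℝ) * |(1 : ℝ) - (-1)|) atTop (𝓝 0) := by
      simpa using (tendsto_rpow_neg_atTop (y := 2) two_pos).mul_const |(1 : ℝ) - (-1)|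
    refine squeeze_zero_norm' ?_ h0
    filter_upwards [hbound] with R hR
    refine intervalIntegral.norm_integral_le_of_norm_le_const fun y hy => hR y ?_
    rw [uIoc_of_le (by norm_num)] at hy
    exact Ioc_subset_Icc_self hy
  have htot := (((hlim (-1) (by simp)).sub (hlim 1 (by simp))).add (hright.const_mul I)).sub_const
    (I * ∫ y in (-1 : ℝ)..1, (a + y * I - p : ℂ)⁻¹ * g (a + y * I))
  rw [mul_zero, add_zero] at htot
  refine tendsto_nhds_unique htot (tendsto_const_nhds.congr' ?_)
  filter_upwards [eventually_gt_atTop p] with R hR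
  refine (integral_boundary_rect_inv_sub_mul (z := ⟨a, -1⟩) (w := ⟨R, 1⟩) (p := p)
    hap hR (by simp) (by simp) (hg.mono fun q hq => ?_)).symm
  have hq1 := hq.1
  simp only [mem_preimage, uIcc_of_le (hap.trans hR).le] at hq1
  exact hq1.1

end

/-- Lemma C.3: for `t₀ > 0`, `0 < a < 1/t₀`, `c ≥ 0`, `b > 0`, `k > 0`, the
contour integral of `f(λ) = t₀ (λ t₀ - 1)⁻¹ λ^c exp (-b λ^k)` along
`σ₁(t) = -t + i` (`t ≤ -a`, `dλ = -dt`), `σ₂(t) = a - t i` (`t ∈ [-1,1]`, `dλ = -i dt`),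
`σ₃(t) = t - i` (`t ≥ a`, `dλ = dt`) converges absolutely and equals
`2 π i t₀^(-c) exp (-b t₀^(-k))`. -/
theorem statement18 (t₀ a c b k : ℝ) (ht₀ : 0 < t₀) (ha : 0 < a) (ha' : a < 1 / t₀)
    (hc : 0 ≤ c) (hb : 0 < b) (hk : 0 < k)
    (f : ℂ → ℂ)
    (hf : ∀ l : ℂ, f l =
      (t₀ : ℂ) * (l * (t₀ : ℂ) - 1)⁻¹ * l ^ (c : ℂ) * Complex.exp (-(b : ℂ) * l ^ (k : ℂ))) :
    IntegrableOn (fun t : ℝ => f ((-t : ℂ) + Complex.I)) (Set.Iic (-a)) ∧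
    IntervalIntegrable (fun t : ℝ => f ((a : ℂ) - (t : ℂ) * Complex.I)) volume (-1) 1 ∧
    IntegrableOn (fun t : ℝ => f ((t : ℂ) - Complex.I)) (Set.Ici a) ∧
    -(∫ t in Set.Iic (-a), f ((-t : ℂ) + Complex.I)) -
        Complex.I * (∫ t in (-1:ℝ)..1, f ((a : ℂ) - (t : ℂ) * Complex.I)) +
        (∫ t in Set.Ici a, f ((t : ℂ) - Complex.I)) =
      2 * (Real.pi : ℂ) * Complex.I *
        ((t₀ ^ (-c) * Real.exp (-b * t₀ ^ (-k)) : ℝ) : ℂ) := by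

  set p : ℝ := t₀⁻¹ with hp
  have hp0 : 0 < p := inv_pos.2 ht₀
  have hap : a < p := by rwa [hp, ← one_div]
  set g : ℂ → ℂ := fun l => l ^ (c : ℂ) * Complex.exp (-(b : ℂ) * l ^ (k : ℂ)) with hgdef
  have hg : DifferentiableOn ℂ g {z | a ≤ z.re} := fun z hz => by
    have hz' : z ∈ slitPlane := Or.inl (ha.trans_le hz)
    refine DifferentiableAt.differentiableWithinAt ?_
    have h1 : ∀ s : ℂ, DifferentiableAt ℂ (fun l : ℂ => l ^ s) z := fun s =>
      differentiableAt_id.cpow_const hz'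
    exact (h1 _).mul ((h1 _).const_mul _).cexp
  have hfg : ∀ l : ℂ, f l = (l - p)⁻¹ * g l := fun l => by
    have ht : (t₀ : ℂ) ≠ 0 := by exact_mod_cast ht₀.ne'
    have h1 : l * t₀ - 1 = t₀ * (l - p) := by
      rw [hp]
      push_cast
      field_simp
    rw [hf, h1, mul_inv, mul_inv_cancel_left₀ ht, hgdef, mul_assoc]
  have hgp : g p = ((t₀ ^ (-c) * Real.exp (-b * t₀ ^ (-k)) : ℝ) : ℂ) := by
    simp only [hgdef]
    rw [← ofReal_cpow hp0.le, ← ofReal_cpow hp0.le, hp, Real.inv_rpow ht₀.le,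
      Real.inv_rpow ht₀.le, ← Real.rpow_neg ht₀.le, ← Real.rpow_neg ht₀.le]
    push_cast
    rfl
  obtain ⟨h1, h2, h3⟩ := integral_boundary_halfStrip_inv_sub_mul hap hg
    (eventually_norm_cpow_mul_exp_neg_le hc hb hk)
  simp only [← hfg] at h1 h2 h3
  have hlow := h1 (-1) (by simp)
  have hupp := h1 1 (by simp)
  have hm : ∀ t : ℝ, (t : ℂ) + ((-1 : ℝ) : ℂ) * I = t - I := fun t => by push_cast; ring
  have ho : ∀ t : ℝ, (t : ℂ) + ((1 : ℝ) : ℂ) * I = t + I := fun t => by push_cast; ring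
  have hn : ∀ t : ℝ, (a : ℂ) - t * I = a + ((-t : ℝ) : ℂ) * I := fun t => by push_cast; ring
  have hn' : ∀ t : ℝ, -(t : ℂ) + I = ((-t : ℝ) : ℂ) + I := fun t => by push_cast; ring
  simp only [hm, ho] at h3 hlow hupp
  simp only [hn, hn']
  refine ⟨?_, ?_, hlow, ?_⟩
  · exact IntegrableOn.comp_neg_Iic (c := -a) (f := fun x : ℝ => f (x + I)) (by simpa using hupp)
  · simpa using ((IntervalIntegrable.iff_comp_neg).1 h2).symm
  · rw [integral_comp_neg_Iic (-a) (fun x : ℝ => f (x + I)), neg_neg,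
      ← integral_Ici_eq_integral_Ioi,
      intervalIntegral.integral_comp_neg (fun y : ℝ => f (a + y * I)), neg_neg, ← hgp, ← h3]
    ring
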